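/- arXiv:2110.05079 — 6 statements merged into one kernel-verified Lean document; each statement's English description precedes it below -/
import Mathlib

section
/- Let c > 0, κ ≥ 1 and θ, β ∈ [0,1). Let I be a set of positive integers and, for each n ∈ I, let t_n ∈ [κ⁻¹, ∞) satisfy |t_n − cn| ≤ κ n^β. Then there exists a constant C, depending only on κ, c, θ and β, such that for every a > 0 and every b with 0 < b ≤ κa, the sum over those n ∈ I with t_n ≤ κa of min{a^{θ−1}|t_n − b|^{−θ}, a^{−β}} is at most C (when t_n = b the minimum is interpreted as a^{−β}). -/
open Finset in
/-- A sum of a nonnegative function of the distance to `k` is at most twice the sum over all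
possible distances, since each distance is attained at most twice. -/
lemma sum_dist_le_two_mul_sum_range (S : Finset ℕ) (k N : ℕ) (G : ℕ → ℝ) (hG : ∀ m, 0 ≤ G m)
    (hS : ∀ n ∈ S, Nat.dist n k ≤ N) :
    ∑ n ∈ S, G (Nat.dist n k) ≤ 2 * ∑ m ∈ range (N + 1), G m := by
  rw [← sum_fiberwise_of_maps_to (g := fun n => Nat.dist n k) (t := range (N + 1))
    (fun n hn => mem_range.2 (Nat.lt_succ_of_le (hS n hn))), mul_sum]
  refine sum_le_sum fun m _ => ?_
  have hcard : #{n ∈ S | Nat.dist n k = m} ≤ 2 := by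
    refine (card_le_card (t := {k + m, k - m}) fun n hn => ?_).trans card_le_two
    have := (mem_filter.1 hn).2
    simp only [Nat.dist, mem_insert, mem_singleton] at this ⊢
    omega
  calc ∑ n ∈ S with Nat.dist n k = m, G (Nat.dist n k)
      = ∑ n ∈ S with Nat.dist n k = m, G m :=
        sum_congr rfl fun n hn => by rw [(mem_filter.1 hn).2]
    _ = #{n ∈ S | Nat.dist n k = m} * G m := by rw [sum_const, nsmul_eq_mul]
    _ ≤ 2 * G m := by
        gcongr
        · exact hG m
        · exact_mod_cast hcard

lemma sum_rpow_neg_le (θ : ℝ) (hθ0 : 0 ≤ θ) (hθ1 : θ < 1) (N : ℕ) :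
    ∑ m ∈ Finset.range (N + 1), (if m = 0 then 0 else (m : ℝ) ^ (-θ)) ≤
      (N : ℝ) ^ (1 - θ) / (1 - θ) := by
  have h1 : 0 < 1 - θ := by linarith
  induction N with
  | zero => simp [Real.zero_rpow h1.ne']
  | succ N ih =>
    rw [Finset.sum_range_succ, if_neg (Nat.succ_ne_zero N)]
    have hx : (0 : ℝ) < (N + 1 : ℕ) := by positivity
    set x : ℝ := ((N + 1 : ℕ) : ℝ) with hxdef
    have hN : (N : ℝ) = x * (1 + -x⁻¹) := by
      have : (N : ℝ) = x - 1 := by rw [hxdef]; push_cast; ring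
      rw [this]; field_simp; ring
    have hx1 : x⁻¹ ≤ 1 := 
      inv_le_one_of_one_le₀ (by rw [hxdef]; exact_mod_cast N.succ_pos)
    have hb := rpow_one_add_le_one_add_mul_self (s := -x⁻¹) (by linarith) h1.le
      (by linarith : 1 - θ ≤ 1)
    have hstep : (N : ℝ) ^ (1 - θ) ≤ x ^ (1 - θ) - (1 - θ) * x ^ (-θ) := by
      rw [hN, Real.mul_rpow hx.le (by linarith)]
      calc x ^ (1 - θ) * (1 + -x⁻¹) ^ (1 - θ)
          ≤ x ^ (1 - θ) * (1 + (1 - θ) * -x⁻¹) := by gcongr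
        _ = x ^ (1 - θ) - (1 - θ) * x ^ (-θ) := by
            rw [show -θ = (1 - θ) - 1 by ring, Real.rpow_sub_one hx.ne']; ring
    calc _ ≤ (N : ℝ) ^ (1 - θ) / (1 - θ) + x ^ (-θ) := by gcongr
      _ ≤ (x ^ (1 - θ) - (1 - θ) * x ^ (-θ)) / (1 - θ) + x ^ (-θ) := by gcongr
      _ = x ^ (1 - θ) / (1 - θ) := by field_simp; ring

lemma sum_ite_le_le (L v : ℝ) (hL : 0 ≤ L) (hv : 0 ≤ v) (N : ℕ) :
    ∑ m ∈ Finset.range N, (if (m : ℝ) ≤ L then v else 0) ≤ (L + 1) * v := by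
  rw [← Finset.sum_filter, Finset.sum_const, nsmul_eq_mul]
  gcongr
  have : (Finset.range N).filter (fun m : ℕ => (m : ℝ) ≤ L) ⊆ Finset.range (⌊L⌋₊ + 1) := by
    intro m hm
    exact Finset.mem_range.2 (Nat.lt_succ_of_le (Nat.le_floor (Finset.mem_filter.1 hm).2))
  calc (_ : ℝ) ≤ ((⌊L⌋₊ + 1 : ℕ) : ℝ) := by
        exact_mod_cast (Finset.card_le_card this).trans_eq (Finset.card_range _)
    _ ≤ L + 1 := by push_cast; linarith [Nat.floor_le hL]

lemma exists_le_mul_of_mul_le_add_rpow (c κ β δ : ℝ) (hc : 0 < c) (hκ : 0 < κ) (hδ : 0 < δ)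
    (hβ1 : β < 1) :
    ∃ M : ℝ, 0 < M ∧ ∀ a x : ℝ, δ ≤ a → 0 ≤ x → c * x ≤ κ * a + κ * x ^ β → x ≤ M * a := by
  have h1 : 0 < 1 - β := by linarith
  set R : ℝ := (2 * κ / c) ^ (1 - β)⁻¹ with hR
  have hR0 : 0 < R := by positivity
  refine ⟨R / δ + 2 * κ / c, by positivity, fun a x ha hx h => ?_⟩
  have ha0 : 0 < a := hδ.trans_le ha
  rw [add_mul]
  rcases le_or_gt x R with hxR | hxR
  · have : R ≤ R / δ * a := by
      rw [div_mul_eq_mul_div, le_div_iff₀ hδ]; gcongr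
    have : 0 < 2 * κ / c * a := by positivity
    linarith
  · have hx0 : 0 < x := hR0.trans hxR
    have hpow : 2 * κ / c ≤ x ^ (1 - β) := by
      calc 2 * κ / c = R ^ (1 - β) := by
            rw [hR, Real.rpow_inv_rpow (by positivity) h1.ne']
        _ ≤ x ^ (1 - β) := by gcongr
    have hmul : x ^ (1 - β) * x ^ β = x := by
      rw [← Real.rpow_add hx0]; simp
    have hhalf : κ * x ^ β ≤ c / 2 * x := by
      calc κ * x ^ β = c / 2 * (2 * κ / c * x ^ β) := by field_simp
        _ ≤ c / 2 * (x ^ (1 - β) * x ^ β) := by gcongr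
        _ = c / 2 * x := by rw [hmul]
    have : x ≤ 2 * κ / c * a := by
      rw [div_mul_eq_mul_div, le_div_iff₀ hc]; linarith
    have : 0 < R / δ * a := by positivity
    linarith

lemma Nat.abs_cast_sub_cast_eq_dist (n k : ℕ) : |(n : ℝ) - k| = (Nat.dist n k : ℝ) := by
  rcases le_total n k with h | h
  · rw [Nat.dist_eq_sub_of_le h, Nat.cast_sub h, abs_sub_comm, abs_of_nonneg]
    exact sub_nonneg.2 (by exact_mod_cast h)
  · rw [Nat.dist_eq_sub_of_le_right h, Nat.cast_sub h, abs_of_nonneg]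
    exact sub_nonneg.2 (by exact_mod_cast h)

/-- Each summand is controlled by the distance of its index from `⌊b / c⌋₊`: by `a ^ (-β)` up to
distance `2 + 2 * w / c`, and by a multiple of the `-θ` power of the distance beyond. -/
lemma summand_le_of_dist (c θ β a b s w : ℝ) (n : ℕ) (hc : 0 < c) (hθ0 : 0 ≤ θ) (ha : 0 < a)
    (hb : 0 < b) (hw : 0 ≤ w) (hs : |s - c * n| ≤ w) :
    (if s = b then a ^ (-β) else min (a ^ (θ - 1) * |s - b| ^ (-θ)) (a ^ (-β))) ≤
      (if (Nat.dist n ⌊b / c⌋₊ : ℝ) ≤ 2 + 2 * w / c then a ^ (-β) else 0) +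
        (c / 2) ^ (-θ) * a ^ (θ - 1) *
          (if Nat.dist n ⌊b / c⌋₊ = 0 then 0 else (Nat.dist n ⌊b / c⌋₊ : ℝ) ^ (-θ)) := by
  set k := ⌊b / c⌋₊ with hk
  set m := Nat.dist n k with hm
  have hle : (if s = b then a ^ (-β) else min (a ^ (θ - 1) * |s - b| ^ (-θ)) (a ^ (-β))) ≤
      a ^ (-β) := by
    split_ifs
    exacts [le_rfl, min_le_right _ _]
  rcases le_or_gt (m : ℝ) (2 + 2 * w / c) with hmL | hmL
  · rw [if_pos hmL]
    refine hle.trans (le_add_of_nonneg_right (mul_nonneg (by positivity) ?_))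
    split_ifs <;> positivity
  · have hm0 : (0 : ℝ) < m := lt_trans (by positivity) hmL
    have hm0' : m ≠ 0 := by exact_mod_cast hm0.ne'
    have hcm : 2 * c + 2 * w ≤ c * m := by
      calc 2 * c + 2 * w = c * (2 + 2 * w / c) := by field_simp
        _ ≤ c * m := by gcongr
    have hdist : c * m - c ≤ |c * n - b| := by
      have hkb : |(k : ℝ) - b / c| ≤ 1 := by
        rw [abs_le]
        constructor <;> linarith [Nat.floor_le (show 0 ≤ b / c by positivity),
          Nat.lt_floor_add_one (b / c)]
      have hnb : (m : ℝ) - 1 ≤ |(n : ℝ) - b / c| := by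
        rw [hm, ← Nat.abs_cast_sub_cast_eq_dist]
        linarith [abs_sub_le (n : ℝ) (b / c) k, abs_sub_comm (k : ℝ) (b / c)]
      calc c * m - c = c * (m - 1) := by ring
        _ ≤ c * |(n : ℝ) - b / c| := by gcongr
        _ = |c * n - b| := by
          rw [← abs_of_pos hc, ← abs_mul, abs_of_pos hc, mul_sub, mul_div_cancel₀ _ hc.ne']
    have hsb : c / 2 * m ≤ |s - b| := by
      linarith [abs_sub_le (c * n) s b, abs_sub_comm s (c * n)]
    have hne : s ≠ b := by
      rintro rfl
      rw [sub_self, abs_zero] at hsb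
      exact absurd hsb (not_le.2 (by positivity))
    rw [if_neg hne, if_neg hmL.not_ge, if_neg hm0', zero_add]
    calc _ ≤ a ^ (θ - 1) * |s - b| ^ (-θ) := min_le_left _ _
      _ ≤ a ^ (θ - 1) * (c / 2 * m) ^ (-θ) := by
          gcongr ?_ * ?_
          exact Real.rpow_le_rpow_of_nonpos (by positivity) hsb (by linarith)
      _ = (c / 2) ^ (-θ) * a ^ (θ - 1) * (m : ℝ) ^ (-θ) := by
          rw [Real.mul_rpow (by positivity) hm0.le]; ring


/-- Summation lemma: for `t_n` with `|t_n - c n| ≤ κ n^β`, the sum of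
`min (a^(θ-1) |t_n - b|^(-θ)) (a^(-β))` over those `n ∈ I` with `t_n ≤ κ a`
is bounded by a constant depending only on `κ, c, θ, β` (uniformly in `a, b`
with `0 < b ≤ κ a`); when `t_n = b` the summand is interpreted as `a^(-β)`. -/
theorem summation_lemma (c κ θ β : ℝ) (hc : 0 < c) (hκ : 1 ≤ κ)
    (hθ0 : 0 ≤ θ) (hθ1 : θ < 1) (hβ0 : 0 ≤ β) (hβ1 : β < 1) :
    ∃ C : ℝ, 0 < C ∧
      ∀ (I : Set ℕ) (t : ℕ → ℝ),
        (∀ n ∈ I, 1 ≤ n) →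
        (∀ n ∈ I, κ⁻¹ ≤ t n) →
        (∀ n ∈ I, |t n - c * n| ≤ κ * (n : ℝ) ^ β) →
        ∀ a b : ℝ, 0 < a → 0 < b → b ≤ κ * a →
          Summable (fun n : {n : ℕ // n ∈ I ∧ t n ≤ κ * a} =>
            if t n.1 = b then a ^ (-β)
            else min (a ^ (θ - 1) * |t n.1 - b| ^ (-θ)) (a ^ (-β))) ∧
          (∑' n : {n : ℕ // n ∈ I ∧ t n ≤ κ * a},
            if t n.1 = b then a ^ (-β)
            else min (a ^ (θ - 1) * |t n.1 - b| ^ (-θ)) (a ^ (-β))) ≤ C := by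
  have hsub : 0 < 1 - θ := by linarith
  have hκ0 : 0 < κ := by linarith
  obtain ⟨M, hM, hMle⟩ := exists_le_mul_of_mul_le_add_rpow c κ β (κ⁻¹ / κ) hc hκ0
    (by positivity) hβ1
  set E : ℝ := (κ⁻¹ / κ) ^ (-β) with hE
  set D : ℝ := κ * M ^ β with hD
  set K : ℝ := (c / 2) ^ (-θ) with hK
  set P : ℝ := M + κ / c with hP
  have hE0 : 0 < E := by positivity
  have hD0 : 0 < D := by positivity
  have hK0 : 0 < K := by positivity
  have hP0 : 0 < P := by positivity
  have hC0 : 0 < 2 * (3 * E + 2 * D / c + K * (P ^ (1 - θ) / (1 - θ))) := by positivity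
  refine ⟨2 * (3 * E + 2 * D / c + K * (P ^ (1 - θ) / (1 - θ))), hC0,
    fun I t _ htκ htc a b ha hb hba => ?_⟩
  set F : ℕ → ℝ := fun n => if t n = b then a ^ (-β)
    else min (a ^ (θ - 1) * |t n - b| ^ (-θ)) (a ^ (-β)) with hF
  have hF0 : ∀ n, 0 ≤ F n := fun n => by
    simp only [hF]; split_ifs <;> positivity
  suffices hfin : ∀ S : Finset {n : ℕ // n ∈ I ∧ t n ≤ κ * a},
      ∑ n ∈ S, F n.1 ≤ 2 * (3 * E + 2 * D / c + K * (P ^ (1 - θ) / (1 - θ))) from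
    ⟨summable_of_sum_le (fun n => hF0 n.1) hfin,
      Real.tsum_le_of_sum_le (fun n => hF0 n.1) hfin⟩
  intro S
  rcases S.eq_empty_or_nonempty with rfl | ⟨n₀, -⟩
  · simpa using hC0.le
  have haδ : κ⁻¹ / κ ≤ a := by
    rw [div_le_iff₀ hκ0, mul_comm a]
    exact (htκ _ n₀.2.1).trans n₀.2.2
  have hnM : ∀ n : {n : ℕ // n ∈ I ∧ t n ≤ κ * a}, (n.1 : ℝ) ≤ M * a := fun n =>
    hMle a n haδ n.1.cast_nonneg (by
      linarith [(abs_le.1 (htc n n.2.1)).1, n.2.2])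
  have hw : ∀ n : {n : ℕ // n ∈ I ∧ t n ≤ κ * a}, |t n - c * n.1| ≤ D * a ^ β := fun n => by
    refine (htc n n.2.1).trans ?_
    rw [hD, mul_assoc, ← Real.mul_rpow hM.le ha.le]
    gcongr
    exact hnM n
  have hxa : b / c ≤ κ / c * a := by
    rw [div_mul_eq_mul_div]; gcongr
  set k := ⌊b / c⌋₊ with hk
  have hka : (k : ℝ) ≤ κ / c * a := (Nat.floor_le (by positivity)).trans hxa
  set N := ⌊P * a⌋₊ with hN
  have hdist : ∀ n ∈ S.map (Function.Embedding.subtype _), Nat.dist n k ≤ N := by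
    intro n hn
    obtain ⟨n, -, rfl⟩ := Finset.mem_map.1 hn
    refine Nat.le_floor ?_
    rw [← Nat.abs_cast_sub_cast_eq_dist, hP, add_mul, abs_le]
    have := hnM n
    have h1 : (0 : ℝ) ≤ n.1 := n.1.cast_nonneg
    have h2 : (0 : ℝ) ≤ k := k.cast_nonneg
    simp only [Function.Embedding.subtype_apply]
    constructor <;> nlinarith
  set G : ℕ → ℝ := fun m => (if (m : ℝ) ≤ 2 + 2 * (D * a ^ β) / c then a ^ (-β) else 0) +
    K * a ^ (θ - 1) * (if m = 0 then 0 else (m : ℝ) ^ (-θ)) with hG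
  have hG0 : ∀ m, 0 ≤ G m := fun m => by
    simp only [hG]
    refine add_nonneg ?_ (mul_nonneg (by positivity) ?_) <;> split_ifs <;> positivity
  have haE : a ^ (-β) ≤ E := Real.rpow_le_rpow_of_nonpos (by positivity) haδ (by linarith)
  have hnear : ∑ m ∈ Finset.range (N + 1),
      (if (m : ℝ) ≤ 2 + 2 * (D * a ^ β) / c then a ^ (-β) else 0) ≤ 3 * E + 2 * D / c := by
    refine (sum_ite_le_le _ _ (by positivity) (by positivity) _).trans ?_
    have : a ^ β * a ^ (-β) = 1 := by rw [← Real.rpow_add ha]; simp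
    calc (2 + 2 * (D * a ^ β) / c + 1) * a ^ (-β)
        = 3 * a ^ (-β) + 2 * D / c * (a ^ β * a ^ (-β)) := by ring
      _ ≤ 3 * E + 2 * D / c := by rw [this, mul_one]; gcongr
  have hfar : K * a ^ (θ - 1) * ∑ m ∈ Finset.range (N + 1),
      (if m = 0 then 0 else (m : ℝ) ^ (-θ)) ≤ K * (P ^ (1 - θ) / (1 - θ)) := by
    have hone : a ^ (θ - 1) * a ^ (1 - θ) = 1 := by rw [← Real.rpow_add ha]; simp
    calc K * a ^ (θ - 1) * _ ≤ K * a ^ (θ - 1) * ((P * a) ^ (1 - θ) / (1 - θ)) := by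
          gcongr
          refine (sum_rpow_neg_le θ hθ0 hθ1 N).trans ?_
          gcongr
          exact Nat.floor_le (by positivity)
      _ = K * (P ^ (1 - θ) / (1 - θ)) * (a ^ (θ - 1) * a ^ (1 - θ)) := by
          rw [Real.mul_rpow hP0.le ha.le]; ring
      _ = K * (P ^ (1 - θ) / (1 - θ)) := by rw [hone, mul_one]
  calc ∑ n ∈ S, F n.1 ≤ ∑ n ∈ S, G (Nat.dist n.1 k) :=
        Finset.sum_le_sum fun n _ =>
          summand_le_of_dist c θ β a b (t n) (D * a ^ β) n hc hθ0 ha hb (by positivity) (hw n)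
    _ = ∑ n ∈ S.map (Function.Embedding.subtype _), G (Nat.dist n k) := by
        rw [Finset.sum_map]; rfl
    _ ≤ 2 * ∑ m ∈ Finset.range (N + 1), G m :=
        sum_dist_le_two_mul_sum_range _ k N G hG0 hdist
    _ ≤ 2 * (3 * E + 2 * D / c + K * (P ^ (1 - θ) / (1 - θ))) := by
        rw [hG, Finset.sum_add_distrib, ← Finset.mul_sum]
        gcongr
end

section
/- Let κ ≥ 1 and W ∈ 𝒫̂₁(κ). Then W is strictly increasing and is a bijection of (0,∞) onto (0,∞), and its compositional inverse W^inv : (0,∞) → (0,∞) also belongs to 𝒫̂₁(κ). -/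
/-- The class `𝒫̂₁(κ)`: C¹ functions `W : (0,∞) → (0,∞)` with
`κ⁻¹ W(x) ≤ x W'(x) ≤ κ W(x)` for all `x > 0`. -/
def P1hat (κ : ℝ) (W : ℝ → ℝ) : Prop :=
  (∀ x : ℝ, 0 < x → 0 < W x) ∧
  (∀ x : ℝ, 0 < x → DifferentiableAt ℝ W x) ∧
  ContinuousOn (deriv W) (Set.Ioi 0) ∧
  (∀ x : ℝ, 0 < x → κ⁻¹ * W x ≤ x * deriv W x ∧ x * deriv W x ≤ κ * W x)

open Set Topology

namespace P1hat

variable {κ : ℝ} {W : ℝ → ℝ}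

lemma deriv_pos (hκ : 0 < κ) (hW : P1hat κ W) {x : ℝ} (hx : 0 < x) : 0 < deriv W x := by
  have h : 0 < x * deriv W x :=
    (mul_pos (inv_pos.2 hκ) (hW.1 x hx)).trans_le (hW.2.2.2 x hx).1
  exact pos_of_mul_pos_right h hx.le

lemma continuousOn (hW : P1hat κ W) : ContinuousOn W (Ioi 0) :=
  fun x hx => (hW.2.1 x hx).continuousAt.continuousWithinAt

lemma strictMonoOn (hκ : 0 < κ) (hW : P1hat κ W) : StrictMonoOn W (Ioi 0) := by
  refine strictMonoOn_of_deriv_pos (convex_Ioi 0) hW.continuousOn fun x hx => ?_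
  rw [interior_Ioi] at hx
  exact hW.deriv_pos hκ hx

lemma monotoneOn_mul_rpow_neg (hW : P1hat κ W) :
    MonotoneOn (fun x => W x * x ^ (-κ⁻¹)) (Ioi 0) := by
  have hd : ∀ x : ℝ, 0 < x → HasDerivAt (fun x => W x * x ^ (-κ⁻¹))
      (deriv W x * x ^ (-κ⁻¹) + W x * (-κ⁻¹ * x ^ (-κ⁻¹ - 1))) x := fun x hx =>
    (hW.2.1 x hx).hasDerivAt.mul (Real.hasDerivAt_rpow_const (Or.inl hx.ne'))
  refine monotoneOn_of_deriv_nonneg (convex_Ioi 0)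
    (fun x hx => (hd x hx).continuousAt.continuousWithinAt) ?_ ?_
  · rw [interior_Ioi]
    exact fun x hx => (hd x hx).differentiableAt.differentiableWithinAt
  · rw [interior_Ioi]
    intro x hx
    have hx' : 0 < x := hx
    have hsplit : x ^ (-κ⁻¹) = x ^ (-κ⁻¹ - 1) * x := by
      rw [← Real.rpow_add_one hx'.ne', sub_add_cancel]
    rw [(hd x hx').deriv, hsplit]
    have h : 0 ≤ x ^ (-κ⁻¹ - 1) * (x * deriv W x - κ⁻¹ * W x) :=
      mul_nonneg (Real.rpow_nonneg hx'.le _) (sub_nonneg.2 (hW.2.2.2 x hx').1)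
    linarith

lemma mul_rpow_le (hW : P1hat κ W) {x : ℝ} (hx : 1 ≤ x) : W 1 * x ^ κ⁻¹ ≤ W x := by
  have hx0 : 0 < x := one_pos.trans_le hx
  have h := hW.monotoneOn_mul_rpow_neg (mem_Ioi.2 one_pos) (mem_Ioi.2 hx0) hx
  simp only [Real.one_rpow, mul_one, Real.rpow_neg hx0.le, ← div_eq_mul_inv] at h
  exact (le_div_iff₀ (Real.rpow_pos_of_pos hx0 _)).1 h

lemma le_mul_rpow (hW : P1hat κ W) {x : ℝ} (hx0 : 0 < x) (hx : x ≤ 1) :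
    W x ≤ W 1 * x ^ κ⁻¹ := by
  have h := hW.monotoneOn_mul_rpow_neg (mem_Ioi.2 hx0) (mem_Ioi.2 one_pos) hx
  simp only [Real.one_rpow, mul_one, Real.rpow_neg hx0.le, ← div_eq_mul_inv] at h
  exact (div_le_iff₀ (Real.rpow_pos_of_pos hx0 _)).1 h

lemma surjOn (hκ : 0 < κ) (hW : P1hat κ W) : SurjOn W (Ioi 0) (Ioi 0) := by
  intro y hy
  have h1 : 0 < W 1 := hW.1 1 one_pos
  have hq : 0 < y / W 1 := div_pos hy h1
  set z : ℝ := (y / W 1) ^ κ with hz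
  have hz0 : 0 < z := Real.rpow_pos_of_pos hq _
  have hzy : W 1 * z ^ κ⁻¹ = y := by
    rw [hz, Real.rpow_rpow_inv hq.le hκ.ne', mul_div_cancel₀ _ h1.ne']
  have one_mem : (1 : ℝ) ∈ Ioi (0 : ℝ) := mem_Ioi.2 one_pos
  rcases le_total 1 z with h | h
  · have hy1 : W 1 ≤ y := by
      rw [← hzy]
      exact le_mul_of_one_le_right h1.le (Real.one_le_rpow h (inv_pos.2 hκ).le)
    exact isPreconnected_Ioi.intermediate_value one_mem hz0 hW.continuousOn
      ⟨hy1, hzy ▸ hW.mul_rpow_le h⟩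
  · have hy1 : y ≤ W 1 := by
      rw [← hzy]
      exact mul_le_of_le_one_right h1.le (Real.rpow_le_one hz0.le h (inv_pos.2 hκ).le)
    exact isPreconnected_Ioi.intermediate_value hz0 one_mem hW.continuousOn
      ⟨hzy ▸ hW.le_mul_rpow hz0 h, hy1⟩

lemma bijOn (hκ : 0 < κ) (hW : P1hat κ W) : BijOn W (Ioi 0) (Ioi 0) :=
  ⟨hW.1, (hW.strictMonoOn hκ).injOn, hW.surjOn hκ⟩

lemma of_invOn (hκ : 0 < κ) (hW : P1hat κ W) {V : ℝ → ℝ} (hV : InvOn V W (Ioi 0) (Ioi 0))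
    (hpos : MapsTo V (Ioi 0) (Ioi 0)) : P1hat κ V := by
  have hmono : StrictMonoOn V (Ioi 0) := fun a ha b hb hab => by
    rwa [← (hW.strictMonoOn hκ).lt_iff_lt (hpos ha) (hpos hb), hV.2 ha, hV.2 hb]
  have himage : V '' Ioi 0 = Ioi 0 :=
    (hV.1.surjOn hW.1).image_eq_of_mapsTo hpos
  have hcont : ∀ y : ℝ, 0 < y → ContinuousAt V y := fun y hy =>
    hmono.continuousAt_of_image_mem_nhds (Ioi_mem_nhds hy)
      (himage.symm ▸ Ioi_mem_nhds (mem_Ioi.1 (hpos hy)))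
  have hderiv : ∀ y : ℝ, 0 < y → HasDerivAt V (deriv W (V y))⁻¹ y := fun y hy =>
    (hW.2.1 _ (hpos hy)).hasDerivAt.of_local_left_inverse (hcont y hy)
      (hW.deriv_pos hκ (hpos hy)).ne'
      (Filter.eventually_of_mem (Ioi_mem_nhds hy) fun _ hz => hV.2 hz)
  refine ⟨hpos, fun y hy => (hderiv y hy).differentiableAt, ?_, fun y hy => ?_⟩
  · refine ContinuousOn.congr (f := fun y => (deriv W (V y))⁻¹) ?_
      fun y hy => (hderiv y hy).deriv
    exact (hW.2.2.1.comp (fun y hy => (hcont y hy).continuousWithinAt) hpos).inv₀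
      fun y hy => (hW.deriv_pos hκ (hpos hy)).ne'
  · have hd := hW.deriv_pos hκ (hpos hy)
    obtain ⟨hl, hu⟩ := hW.2.2.2 (V y) (hpos hy)
    rw [hV.2 hy] at hl hu
    rw [(hderiv y hy).deriv, ← div_eq_mul_inv, le_div_iff₀ hd, div_le_iff₀ hd]
    rw [inv_mul_le_iff₀ hκ] at hl
    rw [mul_assoc, inv_mul_le_iff₀ hκ, mul_assoc]
    exact ⟨hu, hl⟩

end P1hat

theorem strictMono_bijective_inverse (κ : ℝ) (hκ : 1 ≤ κ) (W : ℝ → ℝ) (hW : P1hat κ W) :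
    StrictMonoOn W (Set.Ioi 0) ∧ Set.BijOn W (Set.Ioi 0) (Set.Ioi 0) ∧
    ∃ Winv : ℝ → ℝ,
      (∀ x ∈ Set.Ioi (0 : ℝ), Winv (W x) = x) ∧
      (∀ y ∈ Set.Ioi (0 : ℝ), W (Winv y) = y) ∧
      P1hat κ Winv := by
  have hκ0 : 0 < κ := one_pos.trans_le hκ
  have hbij := hW.bijOn hκ0
  have hinv := hbij.invOn_invFunOn
  exact ⟨hW.strictMonoOn hκ0, hbij, Function.invFunOn W (Ioi 0), hinv.1, hinv.2,
    hW.of_invOn hκ0 hinv hbij.surjOn.mapsTo_invFunOn⟩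
end

section
/- Let κ ≥ 1 and W ∈ 𝒫̂₁(κ). Then there exist constants c, C > 0, depending only on κ, such that for all x, y > 0 with x ≥ y one has c·(W(x)/x)·(x − y) ≤ W(x) − W(y) ≤ C·(W(x)/x)·(x − y). -/
theorem monotoneOn_rpow_neg_mul {f : ℝ → ℝ} {p : ℝ}
    (hf : ∀ x : ℝ, 0 < x → DifferentiableAt ℝ f x)
    (h : ∀ x : ℝ, 0 < x → p * f x ≤ x * deriv f x) :
    MonotoneOn (fun x : ℝ => x ^ (-p) * f x) (Set.Ioi 0) := by
  have hd : ∀ x : ℝ, 0 < x → HasDerivAt (fun x : ℝ => x ^ (-p) * f x)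
      (-p * x ^ (-p - 1) * f x + x ^ (-p) * deriv f x) x := fun x hx =>
    (Real.hasDerivAt_rpow_const (Or.inl hx.ne')).mul (hf x hx).hasDerivAt
  refine monotoneOn_of_deriv_nonneg (convex_Ioi 0)
    (fun x hx => (hd x hx).continuousAt.continuousWithinAt) ?_ ?_
  · rw [interior_Ioi]
    exact fun x hx => (hd x hx).differentiableAt.differentiableWithinAt
  · rw [interior_Ioi]
    intro x hx
    have hx : 0 < x := hx
    rw [(hd x hx).deriv]
    have hpow : x ^ (-p) = x ^ (-p - 1) * x := by
      rw [Real.rpow_sub_one hx.ne', div_mul_cancel₀ _ hx.ne']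
    have := mul_nonneg (Real.rpow_nonneg hx.le (-p - 1)) (sub_nonneg.2 (h x hx))
    rw [hpow]
    linarith

theorem le_rpow_div_mul {f : ℝ → ℝ} {p : ℝ}
    (hf : ∀ x : ℝ, 0 < x → DifferentiableAt ℝ f x)
    (h : ∀ x : ℝ, 0 < x → p * f x ≤ x * deriv f x)
    {x y : ℝ} (hy : 0 < y) (hyx : y ≤ x) :
    f y ≤ (y / x) ^ p * f x := by
  have hx : 0 < x := hy.trans_le hyx
  have key : y ^ (-p) * f y ≤ x ^ (-p) * f x :=
    monotoneOn_rpow_neg_mul hf h (Set.mem_Ioi.2 hy) (Set.mem_Ioi.2 hx) hyx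
  have := mul_le_mul_of_nonneg_left key (Real.rpow_nonneg hy.le p)
  rwa [← mul_assoc, ← mul_assoc, ← Real.rpow_add hy, add_neg_cancel, Real.rpow_zero, one_mul,
    Real.rpow_neg hx.le, ← div_eq_mul_inv, ← Real.div_rpow hy.le hx.le] at this

theorem lagrange_comparison (κ : ℝ) (hκ : 1 ≤ κ) :
    ∃ c C : ℝ, 0 < c ∧ 0 < C ∧
      ∀ W : ℝ → ℝ, P1hat κ W →
        ∀ x y : ℝ, 0 < y → y ≤ x →
          c * (W x / x) * (x - y) ≤ W x - W y ∧
          W x - W y ≤ C * (W x / x) * (x - y) := by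
  have hκ0 : 0 < κ := one_pos.trans_le hκ
  refine ⟨κ⁻¹, κ, inv_pos.2 hκ0, hκ0, ?_⟩
  rintro W ⟨hpos, hdiff, -, hW⟩ x y hy hyx
  have hx : 0 < x := hy.trans_le hyx
  have hs : -1 ≤ y / x - 1 := by linarith [div_pos hy hx]
  have hlin : ∀ p : ℝ, p * (W x / x) * (x - y) = W x - (1 + p * (y / x - 1)) * W x := by
    intro p
    field_simp
    ring
  constructor
  · have h₁ := le_rpow_div_mul hdiff (fun z hz => (hW z hz).1) hy hyx
    have h₂ := rpow_one_add_le_one_add_mul_self hs (inv_nonneg.2 hκ0.le) (inv_le_one_of_one_le₀ hκ)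
    rw [add_sub_cancel] at h₂
    rw [hlin]
    linarith [mul_le_mul_of_nonneg_right h₂ (hpos x hx).le]
  · have h₁ := le_rpow_div_mul (f := fun z => -W z) (p := κ) (fun z hz => (hdiff z hz).neg)
      (fun z hz => by
        rw [deriv.fun_neg]
        linarith [(hW z hz).2]) hy hyx
    have h₂ := one_add_mul_self_le_rpow_one_add hs hκ
    rw [add_sub_cancel] at h₂
    rw [hlin]
    linarith [mul_le_mul_of_nonneg_right h₂ (hpos x hx).le]
end

section
/- Let κ ≥ 1 and V ∈ 𝒫₁(κ). Define K_V(t) = t^{−1/2} ∫_ℝ (t − V(x))₊^{1/2} dx for t > 0, where (·)₊ denotes the positive part. Then there exist constants c, C > 0, depending only on κ, such that c·|{V ≤ t}| ≤ K_V(t) ≤ C·|{V ≤ t}| for all t > 0. -/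
open MeasureTheory

/-- The class `𝒫₁(κ)`: continuous `V : ℝ → [0,∞)`, not identically zero,
C¹ off the origin, with `κ⁻¹ V(x) ≤ x V'(x) ≤ κ V(x)` and `V(-x) ≤ κ V(x)`
for all `x ≠ 0`. -/
def P1 (κ : ℝ) (V : ℝ → ℝ) : Prop :=
  Continuous V ∧ (∀ x, 0 ≤ V x) ∧ (∃ x, V x ≠ 0) ∧
  (∀ x : ℝ, x ≠ 0 → DifferentiableAt ℝ V x) ∧
  ContinuousOn (deriv V) {(0 : ℝ)}ᶜ ∧
  (∀ x : ℝ, x ≠ 0 → κ⁻¹ * V x ≤ x * deriv V x ∧ x * deriv V x ≤ κ * V x) ∧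
  (∀ x : ℝ, x ≠ 0 → V (-x) ≤ κ * V x)

/-- The Lebesgue measure of the sublevel set `{V ≤ t}`. -/
noncomputable def subMeas (V : ℝ → ℝ) (t : ℝ) : ℝ :=
  (volume {x : ℝ | V x ≤ t}).toReal

/-- `K_V(t) = t^(-1/2) ∫_ℝ (t - V(x))₊^(1/2) dx`. -/
noncomputable def KV (V : ℝ → ℝ) (t : ℝ) : ℝ :=
  t ^ (-(1 / 2 : ℝ)) * ∫ x : ℝ, Real.sqrt (max (t - V x) 0)

namespace P1

variable {κ : ℝ} {V : ℝ → ℝ}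

theorem hasDerivAt_comp_mul (hV : P1 κ V) {x : ℝ} (hx : x ≠ 0) {s : ℝ} (hs : 0 < s) :
    HasDerivAt (fun u => V (u * x)) (deriv V (s * x) * x) s := by
  have h := (hV.2.2.2.1 (s * x) (mul_ne_zero hs.ne' hx)).hasDerivAt
  have h' : HasDerivAt (fun u : ℝ => u * x) x s := by simpa using (hasDerivAt_id s).mul_const x
  exact h.comp s h'

/-- The radial logarithmic derivative bound, in the radial variable. -/
theorem le_mul_deriv (hV : P1 κ V) {x : ℝ} (hx : x ≠ 0) {s : ℝ} (hs : 0 < s) :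
    κ⁻¹ * V (s * x) ≤ s * (deriv V (s * x) * x) := by
  have h := (hV.2.2.2.2.2.1 (s * x) (mul_ne_zero hs.ne' hx)).1
  linarith

theorem monotoneOn_comp_mul (hκ : 1 ≤ κ) (hV : P1 κ V) {x : ℝ} (hx : x ≠ 0) :
    MonotoneOn (fun s => V (s * x)) (Set.Ioi 0) := by
  apply monotoneOn_of_deriv_nonneg (convex_Ioi 0)
  · exact (hV.1.comp (continuous_id.mul continuous_const)).continuousOn
  · intro s hs
    rw [interior_Ioi] at hs
    exact (hV.hasDerivAt_comp_mul hx hs).differentiableAt.differentiableWithinAt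
  · intro s hs
    rw [interior_Ioi] at hs
    rw [(hV.hasDerivAt_comp_mul hx hs).deriv]
    have h1 : 0 ≤ κ⁻¹ * V (s * x) := mul_nonneg (by positivity) (hV.2.1 _)
    exact nonneg_of_mul_nonneg_right (h1.trans (hV.le_mul_deriv hx hs)) hs

/-- Halving the argument decreases `V` by a definite factor. -/
theorem mul_half_le (hκ : 1 ≤ κ) (hV : P1 κ V) (x : ℝ) :
    (1 + (2 * κ)⁻¹) * V (1 / 2 * x) ≤ V x := by
  have key : ∀ x : ℝ, x ≠ 0 → (1 + (2 * κ)⁻¹) * V (1 / 2 * x) ≤ V x := by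
    intro x hx
    have h := (convex_Icc (1 / 2 : ℝ) 1).mul_sub_le_image_sub_of_le_deriv
      (f := fun s => V (s * x)) (C := κ⁻¹ * V (1 / 2 * x))
      (hV.1.comp (continuous_id.mul continuous_const)).continuousOn
      (fun s hs => by
        rw [interior_Icc] at hs
        exact (hV.hasDerivAt_comp_mul hx
          (by linarith [hs.1])).differentiableAt.differentiableWithinAt)
      (fun s hs => by
        rw [interior_Icc] at hs
        have hs0 : 0 < s := by linarith [hs.1]
        rw [(hV.hasDerivAt_comp_mul hx hs0).deriv]
        have h1 : V (1 / 2 * x) ≤ V (s * x) :=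
          hV.monotoneOn_comp_mul hκ hx (by norm_num : (1 / 2 : ℝ) ∈ Set.Ioi 0) hs0 hs.1.le
        have hκ' : 0 ≤ κ⁻¹ := by positivity
        have h2 := hV.le_mul_deriv hx hs0
        have h3 : 0 ≤ κ⁻¹ * V (s * x) := mul_nonneg hκ' (hV.2.1 _)
        have h4 := nonneg_of_mul_nonneg_right (h3.trans h2) hs0
        have h5 := mul_le_mul_of_nonneg_left h1 hκ'
        nlinarith [hs.2])
      (1 / 2) (by norm_num) 1 (by norm_num) (by norm_num)
    simp only [one_mul] at h
    rw [mul_inv]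
    linarith
  have hclosed : IsClosed {x : ℝ | (1 + (2 * κ)⁻¹) * V (1 / 2 * x) ≤ V x} :=
    isClosed_le (continuous_const.mul (hV.1.comp (continuous_const.mul continuous_id))) hV.1
  have hsub : ({(0 : ℝ)}ᶜ : Set ℝ) ⊆ {x : ℝ | (1 + (2 * κ)⁻¹) * V (1 / 2 * x) ≤ V x} :=
    fun x hx => key x hx
  have := hclosed.closure_subset_iff.2 hsub
  rw [(dense_compl_singleton (0 : ℝ)).closure_eq] at this
  exact this (Set.mem_univ x)

theorem pow_mul_le (hκ : 1 ≤ κ) (hV : P1 κ V) (x : ℝ) (n : ℕ) :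
    (1 + (2 * κ)⁻¹) ^ n * V x ≤ V (2 ^ n * x) := by
  induction n with
  | zero => simp
  | succ n ih =>
    have h := hV.mul_half_le hκ (2 ^ (n + 1) * x)
    rw [show (1 / 2 : ℝ) * (2 ^ (n + 1) * x) = 2 ^ n * x by ring] at h
    have h' : 0 ≤ 1 + (2 * κ)⁻¹ := by positivity
    calc _ = (1 + (2 * κ)⁻¹) * ((1 + (2 * κ)⁻¹) ^ n * V x) := by ring
      _ ≤ _ := (mul_le_mul_of_nonneg_left ih h').trans h

theorem exists_pos (hV : P1 κ V) : ∃ x, 0 < x ∧ 0 < V x ∧ 0 < V (-x) := by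
  have key : ∃ x, x ≠ 0 ∧ V x ≠ 0 := by
    by_contra! h
    obtain ⟨x, hx⟩ := hV.2.2.1
    exact hx (congrFun ((hV.1.ext_on (dense_compl_singleton (0 : ℝ)) continuous_const
      (g := fun _ => 0)) fun y hy => h y hy) x)
  obtain ⟨x, hx, hVx⟩ := key
  have hpos : 0 < V x := lt_of_le_of_ne (hV.2.1 x) hVx.symm
  have hneg : 0 < V (-x) := by
    refine lt_of_le_of_ne (hV.2.1 _) fun h => ?_
    have h1 := hV.2.2.2.2.2.2 (-x) (neg_ne_zero.2 hx)
    rw [neg_neg, ← h] at h1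
    linarith
  rcases hx.lt_or_gt with h | h
  · exact ⟨-x, by linarith, hneg, by simpa using hpos⟩
  · exact ⟨x, h, hpos, hneg⟩

theorem exists_sublevel_subset_Icc (hκ : 1 ≤ κ) (hV : P1 κ V) (t : ℝ) :
    ∃ M : ℝ, {x : ℝ | V x ≤ t} ⊆ Set.Icc (-M) M := by
  obtain ⟨x, hx, hp, hn⟩ := hV.exists_pos
  have hlim := tendsto_pow_atTop_atTop_of_one_lt
    (show (1 : ℝ) < 1 + (2 * κ)⁻¹ from lt_add_of_pos_right 1 (by positivity))
  obtain ⟨n, hn1, hn2⟩ := ((hlim.eventually_gt_atTop (t / V x)).and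
    (hlim.eventually_gt_atTop (t / V (-x)))).exists
  rw [div_lt_iff₀ hp] at hn1
  rw [div_lt_iff₀ hn] at hn2
  have h1 := hn1.trans_le (hV.pow_mul_le hκ x n)
  have h2 := hn2.trans_le (hV.pow_mul_le hκ (-x) n)
  have hM : 0 < 2 ^ n * x := by positivity
  refine ⟨2 ^ n * x, fun y (hy : V y ≤ t) => ?_⟩
  have mono : ∀ z : ℝ, z ≠ 0 → ∀ s, 1 ≤ s → V z ≤ V (s * z) := fun z hz s hs => by
    simpa using hV.monotoneOn_comp_mul hκ hz (show (1 : ℝ) ∈ Set.Ioi 0 by norm_num)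
      (show s ∈ Set.Ioi 0 from lt_of_lt_of_le one_pos hs) hs
  constructor
  · by_contra! hlt
    have h := mono (2 ^ n * -x) (by linarith) (y / (2 ^ n * -x))
      (by rw [one_le_div_of_neg (by linarith)]; linarith)
    rw [div_mul_cancel₀ _ (by linarith)] at h
    linarith
  · by_contra! hlt
    have h := mono (2 ^ n * x) hM.ne' (y / (2 ^ n * x))
      (by rw [one_le_div hM]; linarith)
    rw [div_mul_cancel₀ _ hM.ne'] at h
    linarith

theorem volume_sublevel_ne_top (hκ : 1 ≤ κ) (hV : P1 κ V) (t : ℝ) :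
    volume {x : ℝ | V x ≤ t} ≠ ⊤ := by
  obtain ⟨M, hM⟩ := hV.exists_sublevel_subset_Icc hκ t
  exact ((measure_mono hM).trans_lt measure_Icc_lt_top).ne

theorem subMeas_le_two_mul (hκ : 1 ≤ κ) (hV : P1 κ V) (t : ℝ) :
    subMeas V t ≤ 2 * subMeas V ((1 + (2 * κ)⁻¹)⁻¹ * t) := by
  have hr : 0 < 1 + (2 * κ)⁻¹ := by positivity
  have hsub : {x : ℝ | V x ≤ t} ⊆
      (fun x => (1 / 2 : ℝ) * x) ⁻¹' {x : ℝ | V x ≤ (1 + (2 * κ)⁻¹)⁻¹ * t} := by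
    intro x (hx : V x ≤ t)
    change V (1 / 2 * x) ≤ _
    rw [le_inv_mul_iff₀ hr]
    exact (hV.mul_half_le hκ x).trans hx
  have h := measure_mono (μ := volume) hsub
  rw [Real.volume_preimage_mul_left (by norm_num)] at h
  have h' := ENNReal.toReal_mono
    (ENNReal.mul_ne_top ENNReal.ofReal_ne_top (hV.volume_sublevel_ne_top hκ _)) h
  rw [ENNReal.toReal_mul, ENNReal.toReal_ofReal (abs_nonneg _)] at h'
  norm_num at h'
  simpa [subMeas] using h'

end P1

theorem integral_indicator_sublevel {V : ℝ → ℝ} (hV : Continuous V) (t a : ℝ) :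
    ∫ x, {x : ℝ | V x ≤ t}.indicator (fun _ => a) x = a * subMeas V t := by
  rw [integral_indicator_const _ (isClosed_le hV continuous_const).measurableSet,
    smul_eq_mul, mul_comm]
  rfl

theorem integrable_indicator_sublevel {V : ℝ → ℝ} (hV : Continuous V) {t : ℝ}
    (h : volume {x : ℝ | V x ≤ t} ≠ ⊤) (a : ℝ) :
    Integrable ({x : ℝ | V x ≤ t}.indicator (fun _ => a)) :=
  (integrable_indicator_iff (isClosed_le hV continuous_const).measurableSet).2
    (integrableOn_const h)

theorem KV_comparable (κ : ℝ) (hκ : 1 ≤ κ) :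
    ∃ c C : ℝ, 0 < c ∧ 0 < C ∧
      ∀ V : ℝ → ℝ, P1 κ V → ∀ t : ℝ, 0 < t →
        c * subMeas V t ≤ KV V t ∧ KV V t ≤ C * subMeas V t := by
  have hr : 1 < 1 + (2 * κ)⁻¹ := lt_add_of_pos_right 1 (by positivity)
  set δ : ℝ := (1 + (2 * κ)⁻¹)⁻¹
  have hδ1 : δ < 1 := inv_lt_one_of_one_lt₀ hr
  have hδpos : 0 < √(1 - δ) := Real.sqrt_pos.2 (by linarith)
  refine ⟨√(1 - δ) / 2, 1, by positivity, one_pos, fun V hV t ht => ?_⟩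
  have hfin := hV.volume_sublevel_ne_top hκ
  have hst : 0 < √t := Real.sqrt_pos.2 ht
  have hK : KV V t = (√t)⁻¹ * ∫ x : ℝ, √(max (t - V x) 0) := by
    rw [KV, Real.rpow_neg ht.le, ← Real.sqrt_eq_rpow]
  have hupper : ∀ x, √(max (t - V x) 0) ≤ {x : ℝ | V x ≤ t}.indicator (fun _ => √t) x := by
    intro x
    by_cases hx : V x ≤ t
    · rw [Set.indicator_of_mem (by exact hx)]
      exact Real.sqrt_le_sqrt (max_le (by linarith [hV.2.1 x]) ht.le)
    · rw [Set.indicator_of_notMem (by exact hx), max_eq_right (by linarith), Real.sqrt_zero]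
  have hlower : ∀ x, {x : ℝ | V x ≤ δ * t}.indicator (fun _ => √(1 - δ) * √t) x ≤
      √(max (t - V x) 0) := by
    refine fun x => Set.indicator_apply_le' (fun (hx : V x ≤ δ * t) => ?_)
      fun _ => Real.sqrt_nonneg _
    rw [← Real.sqrt_mul (by linarith)]
    exact Real.sqrt_le_sqrt (le_max_of_le_left (by linarith))
  have hcont : Continuous fun x => √(max (t - V x) 0) :=
    ((continuous_const.sub hV.1).max continuous_const).sqrt
  have hint : Integrable fun x => √(max (t - V x) 0) :=
    (integrable_indicator_sublevel hV.1 (hfin t) √t).mono' hcont.aestronglyMeasurable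
      (.of_forall fun x => by
        rw [Real.norm_of_nonneg (Real.sqrt_nonneg _)]
        exact hupper x)
  have hle := integral_mono hint (integrable_indicator_sublevel hV.1 (hfin t) √t) hupper
  have hge := integral_mono (integrable_indicator_sublevel hV.1 (hfin (δ * t)) _) hint hlower
  rw [integral_indicator_sublevel hV.1] at hle hge
  rw [hK, le_inv_mul_iff₀ hst, inv_mul_le_iff₀ hst, one_mul]
  refine ⟨le_trans ?_ hge, hle⟩
  have h := mul_le_mul_of_nonneg_left (hV.subMeas_le_two_mul hκ t)
    (mul_nonneg hδpos.le hst.le)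
  linarith
end

section
/- Let κ ≥ 1 and V ∈ 𝒫₁(κ). Define K_V(t) = t^{−1/2} ∫_ℝ (t − V(x))₊^{1/2} dx for t > 0, where (·)₊ denotes the positive part. Then K_V is differentiable on (0,∞), and there exist constants c, C > 0, depending only on κ, such that c·|{V ≤ t}| ≤ t·K_V'(t) ≤ C·|{V ≤ t}| for all t > 0. -/
open MeasureTheory

open Set Filter Topology

/-- A function with `x f'(x) ≤ a f(x)` on `(0, ∞)` grows at most like `x ^ a`. -/
lemma mul_rpow_div_le_of_mul_deriv_le {f : ℝ → ℝ} {a : ℝ}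
    (hd : ∀ x, 0 < x → DifferentiableAt ℝ f x)
    (h : ∀ x, 0 < x → x * deriv f x ≤ a * f x) {x y : ℝ} (hx : 0 < x) (hxy : x ≤ y) :
    f y * (x / y) ^ a ≤ f x := by
  have key : ∀ z, 0 < z → HasDerivAt (fun z => f z * z ^ (-a))
      (deriv f z * z ^ (-a) + f z * (-a * z ^ (-a - 1))) z := fun z hz =>
    (hd z hz).hasDerivAt.mul (Real.hasDerivAt_rpow_const (Or.inl hz.ne'))
  have anti : AntitoneOn (fun z => f z * z ^ (-a)) (Ioi 0) := by
    apply antitoneOn_of_deriv_nonpos (convex_Ioi 0)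
    · exact fun z hz => (key z hz).continuousAt.continuousWithinAt
    · intro z hz
      rw [interior_Ioi] at hz
      exact (key z hz).differentiableAt.differentiableWithinAt
    · intro z hz
      rw [interior_Ioi] at hz
      rw [(key z hz).deriv]
      have e : z ^ (-a) = z ^ (-a - 1) * z := by
        rw [← Real.rpow_add_one (ne_of_gt hz)]; ring_nf
      rw [e]
      have := mul_nonneg (Real.rpow_nonneg (le_of_lt hz) (-a - 1)) (sub_nonneg.2 (h z hz))
      linarith
  have hy : 0 < y := hx.trans_le hxy
  have := mul_le_mul_of_nonneg_right (anti hx hy hxy) (Real.rpow_nonneg hx.le a)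
  simp only at this
  rw [mul_assoc (f x), ← Real.rpow_add hx, neg_add_cancel, Real.rpow_zero, mul_one] at this
  rw [Real.div_rpow hx.le hy.le]
  rw [Real.rpow_neg hy.le] at this
  calc _ = _ := by ring
    _ ≤ _ := this

/-- A function with `a f(x) ≤ x f'(x)` on `(0, ∞)` grows at least like `x ^ a`. -/
lemma le_mul_rpow_div_of_le_mul_deriv {f : ℝ → ℝ} {a : ℝ}
    (hd : ∀ x, 0 < x → DifferentiableAt ℝ f x)
    (h : ∀ x, 0 < x → a * f x ≤ x * deriv f x) {x y : ℝ} (hx : 0 < x) (hxy : x ≤ y) :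
    f x ≤ f y * (x / y) ^ a := by
  have := mul_rpow_div_le_of_mul_deriv_le (f := -f) (a := a) (fun z hz => (hd z hz).neg)
    (fun z hz => by rw [deriv.neg]; simp only [Pi.neg_apply]; linarith [h z hz]) hx hxy
  simp only [Pi.neg_apply] at this
  linarith

/-- On a half-line, the sublevel sets of a function with `κ⁻¹ W ≤ x W' ≤ κ W` are `x ≤ X s` for a
differentiable function `X` satisfying the same inequalities. -/
lemma exists_sublevel_endpoint {κ : ℝ} (hκ : 1 ≤ κ) {W : ℝ → ℝ} (hc : Continuous W)
    (h0 : ∀ x, 0 ≤ W x) (hne : ∃ x, 0 < x ∧ 0 < W x)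
    (hd : ∀ x, 0 < x → DifferentiableAt ℝ W x)
    (hl : ∀ x, 0 < x → κ⁻¹ * W x ≤ x * deriv W x)
    (hu : ∀ x, 0 < x → x * deriv W x ≤ κ * W x) :
    (∀ x, 0 < x → 0 < W x) ∧ ∃ X : ℝ → ℝ, ∀ s, 0 < s → 0 < X s ∧
      (∀ x, 0 ≤ x → (W x ≤ s ↔ x ≤ X s)) ∧ DifferentiableAt ℝ X s ∧
      κ⁻¹ * X s ≤ s * deriv X s ∧ s * deriv X s ≤ κ * X s := by
  have hκ0 : 0 < κ := by linarith
  obtain ⟨x₀, hx₀, hW₀⟩ := hne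
  have hgrow : ∀ y, x₀ ≤ y → W x₀ * (y / x₀) ^ κ⁻¹ ≤ W y := by
    intro y hy
    have hy0 : 0 < y := hx₀.trans_le hy
    have := mul_le_mul_of_nonneg_right (le_mul_rpow_div_of_le_mul_deriv hd hl hx₀ hy)
      (Real.rpow_nonneg (div_pos hy0 hx₀).le κ⁻¹)
    rwa [mul_assoc (W y), ← Real.mul_rpow (div_pos hx₀ hy0).le (div_pos hy0 hx₀).le,
      div_mul_div_cancel₀ hy0.ne', div_self hx₀.ne', Real.one_rpow, mul_one] at this
  have hpos : ∀ x, 0 < x → 0 < W x := by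
    intro x hx
    rcases le_total x x₀ with h | h
    · exact lt_of_lt_of_le (mul_pos hW₀ (Real.rpow_pos_of_pos (div_pos hx hx₀) κ))
        (mul_rpow_div_le_of_mul_deriv_le hd hu hx h)
    · exact lt_of_lt_of_le (mul_pos hW₀ (Real.rpow_pos_of_pos (div_pos hx hx₀) _)) (hgrow x h)
  have hzero : W 0 = 0 := by
    refine le_antisymm ?_ (h0 0)
    have hlim : Tendsto (fun x => W x₀ * (x / x₀) ^ κ⁻¹) (𝓝[>] 0) (𝓝 0) := by
      have : Continuous (fun x : ℝ => W x₀ * (x / x₀) ^ κ⁻¹) :=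
        continuous_const.mul ((continuous_id.div_const x₀).rpow_const
          (fun _ => Or.inr (inv_pos.2 hκ0).le))
      have h2 := this.tendsto 0
      simp only [zero_div] at h2
      rw [Real.zero_rpow (inv_pos.2 hκ0).ne', mul_zero] at h2
      exact h2.mono_left nhdsWithin_le_nhds
    refine le_of_tendsto_of_tendsto ((hc.tendsto 0).mono_left nhdsWithin_le_nhds) hlim ?_
    filter_upwards [Ioo_mem_nhdsGT hx₀] with x hx
    exact le_mul_rpow_div_of_le_mul_deriv hd hl hx.1 hx.2.le
  have hderiv : ∀ x, 0 < x → 0 < deriv W x := fun x hx =>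
    pos_of_mul_pos_right (lt_of_lt_of_le (mul_pos (inv_pos.2 hκ0) (hpos x hx)) (hl x hx)) hx.le
  have hmono : StrictMonoOn W (Ici 0) :=
    strictMonoOn_of_deriv_pos (convex_Ici 0) hc.continuousOn
      (fun x hx => hderiv x (by rwa [interior_Ici] at hx))
  have htop : Tendsto W atTop atTop := by
    have h1 : Tendsto (fun y => W x₀ * (y / x₀) ^ κ⁻¹) atTop atTop :=
      ((tendsto_rpow_atTop (inv_pos.2 hκ0)).comp
        (tendsto_id.atTop_div_const hx₀)).const_mul_atTop hW₀
    exact tendsto_atTop_mono' _ ((eventually_ge_atTop x₀).mono hgrow) h1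
  refine ⟨hpos, ?_⟩
  let F : ℝ → ℝ := fun x => W (max x 0) + min x 0
  have hF : ∀ x, 0 ≤ x → F x = W x := fun x hx => by simp [F, hx]
  have hF' : ∀ x, x ≤ 0 → F x = x := fun x hx => by simp [F, hx, hzero]
  have hFc : Continuous F := by fun_prop
  have hFm : StrictMono F := by
    intro x y hxy
    rcases le_or_gt 0 x with hx | hx
    · rw [hF x hx, hF y (hx.trans hxy.le)]
      exact hmono hx (hx.trans hxy.le) hxy
    · rcases le_or_gt 0 y with hy | hy
      · rw [hF' x hx.le, hF y hy]
        exact hx.trans_le (h0 y)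
      · rwa [hF' x hx.le, hF' y hy.le]
  have hFs : Function.Surjective F := by
    refine hFc.surjective ?_ ?_
    · exact htop.congr' ((eventually_ge_atTop 0).mono fun x hx => (hF x hx).symm)
    · exact tendsto_id.congr' ((eventually_le_atBot 0).mono fun x hx => (hF' x hx).symm)
  let e := hFm.orderIsoOfSurjective F hFs
  have he : ∀ s, F (e.symm s) = s := fun s => e.apply_symm_apply s
  refine ⟨e.symm, fun s hs => ?_⟩
  have hX : 0 < e.symm s := hFm.lt_iff_lt.1 (by rw [he, hF' 0 le_rfl]; exact hs)
  have hWX : W (e.symm s) = s := by rw [← hF _ hX.le, he]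
  have hD : HasDerivAt e.symm (deriv W (e.symm s))⁻¹ s := by
    refine HasDerivAt.of_local_left_inverse e.symm.continuous.continuousAt
      (hd _ hX).hasDerivAt (hderiv _ hX).ne' ?_
    filter_upwards [lt_mem_nhds hs] with y hy
    rw [← hF _ (hFm.lt_iff_lt.1 (by rw [he, hF' 0 le_rfl]; exact hy)).le, he]
  refine ⟨hX, fun x hx => ?_, hD.differentiableAt, ?_⟩
  · rw [← hF x hx, ← hFm.le_iff_le (b := e.symm s), he]
  · rw [hD.deriv]
    have h1 := hl _ hX
    have h2 := hu _ hX
    have h3 := hderiv _ hX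
    rw [hWX] at h1 h2
    rw [← div_eq_mul_inv, le_div_iff₀ h3, div_le_iff₀ h3]
    constructor
    · calc κ⁻¹ * e.symm s * deriv W (e.symm s) = κ⁻¹ * (e.symm s * deriv W (e.symm s)) := by ring
        _ ≤ κ⁻¹ * (κ * s) := mul_le_mul_of_nonneg_left h2 (inv_pos.2 hκ0).le
        _ = s := by field_simp
    · calc s = κ * (κ⁻¹ * s) := by field_simp
        _ ≤ κ * (e.symm s * deriv W (e.symm s)) := mul_le_mul_of_nonneg_left h1 hκ0.le
        _ = _ := by ring

/-- The sublevel sets of `V ∈ 𝒫₁(κ)` are bounded, and their measure is a differentiable function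
of the level, comparable to its logarithmic derivative. -/
lemma P1.subMeas_spec {κ : ℝ} (hκ : 1 ≤ κ) {V : ℝ → ℝ} (hV : P1 κ V) :
    (∀ s, s ≤ 0 → subMeas V s = 0) ∧ ∀ s, 0 < s →
      (∃ a b, {x | V x ≤ s} = Icc a b) ∧ DifferentiableAt ℝ (subMeas V) s ∧
      κ⁻¹ * subMeas V s ≤ s * deriv (subMeas V) s ∧
      s * deriv (subMeas V) s ≤ κ * subMeas V s := by
  obtain ⟨hc, h0, ⟨x₁, hx₁⟩, hd, -, hb, hs⟩ := hV
  have hκ0 : 0 < κ := by linarith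
  obtain ⟨x₀, hx₀, hV₀⟩ : ∃ x, x ≠ 0 ∧ V x ≠ 0 := by
    by_contra! H
    have : V = fun _ => 0 := hc.ext_on (dense_compl_singleton 0) continuous_const H
    exact hx₁ (by rw [this])
  have hneg : ∀ x, x ≠ 0 → 0 < V x → 0 < V (-x) := fun x hx h => by
    have := hs (-x) (neg_ne_zero.2 hx)
    rw [neg_neg] at this
    exact pos_of_mul_pos_right (h.trans_le this) hκ0.le
  have hV₀' : 0 < V x₀ := (h0 _).lt_of_ne' hV₀
  obtain ⟨x, hx, hVx⟩ : ∃ x, 0 < x ∧ 0 < V x := by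
    rcases hx₀.lt_or_gt with h | h
    · exact ⟨-x₀, neg_pos.2 h, hneg _ hx₀ hV₀'⟩
    · exact ⟨x₀, h, hV₀'⟩
  obtain ⟨hposX, X, hX⟩ := exists_sublevel_endpoint hκ hc h0 ⟨x, hx, hVx⟩
    (fun x hx => hd x hx.ne') (fun x hx => (hb x hx.ne').1) (fun x hx => (hb x hx.ne').2)
  obtain ⟨hposY, Y, hY⟩ := exists_sublevel_endpoint (W := fun x => V (-x)) hκ
    (hc.comp continuous_neg) (fun x => h0 (-x)) ⟨x, hx, hneg x hx.ne' hVx⟩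
    (fun x hx => (hd (-x) (neg_ne_zero.2 hx.ne')).comp x differentiableAt_id.neg)
    (fun x hx => by
      rw [deriv_comp_neg]
      linarith [(hb (-x) (neg_ne_zero.2 hx.ne')).1])
    (fun x hx => by
      rw [deriv_comp_neg]
      linarith [(hb (-x) (neg_ne_zero.2 hx.ne')).2])
  constructor
  · intro s hs
    have hsub : {x | V x ≤ s} ⊆ {0} := by
      intro x hx
      by_contra hne
      rcases lt_or_gt_of_ne hne with h | h
      · have := hposY (-x) (neg_pos.2 h)
        simp only [neg_neg] at this
        exact absurd (this.trans_le hx) hs.not_gt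
      · exact absurd ((hposX x h).trans_le hx) hs.not_gt
    rw [subMeas, measure_mono_null hsub Real.volume_singleton, ENNReal.toReal_zero]
  · intro s hs
    have hset : ∀ s, 0 < s → {x | V x ≤ s} = Icc (-Y s) (X s) := by
      intro s hs
      obtain ⟨hX0, hXs, -⟩ := hX s hs
      obtain ⟨hY0, hYs, -⟩ := hY s hs
      ext x
      simp only [mem_ofPred_eq, mem_Icc]
      rcases le_total 0 x with h | h
      · rw [hXs x h]
        exact ⟨fun h' => ⟨by linarith, h'⟩, fun h' => h'.2⟩
      · have := hYs (-x) (neg_nonneg.2 h)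
        rw [neg_neg] at this
        rw [this]
        exact ⟨fun h' => ⟨by linarith, by linarith⟩, fun h' => by linarith [h'.1]⟩
    have hm : ∀ s, 0 < s → subMeas V s = X s + Y s := by
      intro s hs
      have h1 := (hX s hs).1
      have h2 := (hY s hs).1
      rw [subMeas, hset s hs, Real.volume_Icc, ENNReal.toReal_ofReal (by linarith)]
      ring
    obtain ⟨-, -, hXd, hXl, hXu⟩ := hX s hs
    obtain ⟨-, -, hYd, hYl, hYu⟩ := hY s hs
    have hD : HasDerivAt (subMeas V) (deriv X s + deriv Y s) s :=
      (hXd.hasDerivAt.add hYd.hasDerivAt).congr_of_eventuallyEq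
        ((lt_mem_nhds hs).mono fun y hy => hm y hy)
    refine ⟨⟨_, _, hset s hs⟩, hD.differentiableAt, ?_⟩
    rw [hD.deriv, hm s hs]
    constructor <;> linarith

/-- Averaging a monotone function over dilations preserves `κ⁻¹ m ≤ s m' ≤ κ m`, and the average
is comparable to `m`. -/
lemma dilation_average_spec {κ : ℝ} (hκ : 1 ≤ κ) {m : ℝ → ℝ} (hm : Monotone m)
    (h0 : ∀ s, 0 ≤ m s) (hd : ∀ s, 0 < s → DifferentiableAt ℝ m s)
    (hl : ∀ s, 0 < s → κ⁻¹ * m s ≤ s * deriv m s)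
    (hu : ∀ s, 0 < s → s * deriv m s ≤ κ * m s) {t : ℝ} (ht : 0 < t) :
    ∃ d, HasDerivAt (fun t => ∫ r in Ioo (0 : ℝ) 1, m (t * (1 - r ^ 2))) d t ∧
      κ⁻¹ * (1 / 2 * (1 / 2) ^ κ) * m t ≤ t * d ∧ t * d ≤ κ * m t := by
  have hκ0 : 0 < κ := by linarith
  have hr : ∀ r ∈ Ioo (0 : ℝ) 1, 0 < 1 - r ^ 2 ∧ 1 - r ^ 2 < 1 := fun r hr =>
    ⟨by nlinarith [hr.1, hr.2], by nlinarith [hr.1, hr.2]⟩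
  have hint : ∀ t, 0 < t → IntegrableOn (fun r : ℝ => m (t * (1 - r ^ 2))) (Ioo 0 1) := by
    intro t ht
    refine Integrable.of_bound (hm.measurable.comp (by fun_prop)).aestronglyMeasurable (m t) ?_
    filter_upwards [ae_restrict_mem measurableSet_Ioo] with r h
    rw [Real.norm_of_nonneg (h0 _)]
    exact hm (by nlinarith [(hr r h).2])
  obtain ⟨hi, hD⟩ := hasDerivAt_integral_of_dominated_loc_of_deriv_le
    (μ := volume.restrict (Ioo (0 : ℝ) 1)) (F := fun t r => m (t * (1 - r ^ 2)))
    (F' := fun t r => deriv m (t * (1 - r ^ 2)) * (1 - r ^ 2)) (x₀ := t)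
    (s := Ioo (t / 2) (2 * t)) (bound := fun _ => κ * m (2 * t) * (2 / t))
    (Ioo_mem_nhds (by linarith) (by linarith))
    ((lt_mem_nhds ht).mono fun y hy => (hint y hy).aestronglyMeasurable) (hint t ht)
    (((measurable_deriv m).comp (by fun_prop)).mul (by fun_prop)).aestronglyMeasurable
    (by
      filter_upwards [ae_restrict_mem measurableSet_Ioo] with r h y hy
      have hy0 : 0 < y := by linarith [hy.1]
      obtain ⟨hr1, hr2⟩ := hr r h
      have hp := mul_pos hy0 hr1
      have h1 : 0 ≤ deriv m (y * (1 - r ^ 2)) :=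
        nonneg_of_mul_nonneg_right ((mul_nonneg (inv_pos.2 hκ0).le (h0 _)).trans (hl _ hp)) hp
      rw [Real.norm_of_nonneg (mul_nonneg h1 hr1.le), mul_div_assoc', le_div_iff₀ ht]
      have h2 := hu _ hp
      have h3 : m (y * (1 - r ^ 2)) ≤ m (2 * t) := hm (by nlinarith [hy.2])
      have h4 := mul_le_mul_of_nonneg_left h3 hκ0.le
      have h5 := mul_nonneg (mul_nonneg h1 hr1.le) (by linarith [hy.1] : 0 ≤ 2 * y - t)
      linarith)
    (integrable_const _)
    (by
      filter_upwards [ae_restrict_mem measurableSet_Ioo] with r h y hy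
      have hp := mul_pos (by linarith [hy.1] : 0 < y) (hr r h).1
      have := (hd _ hp).hasDerivAt.comp y ((hasDerivAt_id y).mul_const (1 - r ^ 2))
      rwa [one_mul] at this)
  refine ⟨_, hD, ?_, ?_⟩
  · have h1 : κ⁻¹ * ∫ r in Ioo (0 : ℝ) 1, m (t * (1 - r ^ 2)) ≤
        t * ∫ r in Ioo (0 : ℝ) 1, deriv m (t * (1 - r ^ 2)) * (1 - r ^ 2) := by
      rw [← integral_const_mul, ← integral_const_mul]
      refine setIntegral_mono_on ((hint t ht).const_mul _) (hi.const_mul _) measurableSet_Ioo ?_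
      intro r h
      have := hl _ (mul_pos ht (hr r h).1)
      linarith
    have h2 : ∫ r in Ioo (0 : ℝ) (1 / 2), m (t * (1 - r ^ 2)) ≤
        ∫ r in Ioo (0 : ℝ) 1, m (t * (1 - r ^ 2)) :=
      setIntegral_mono_set (hint t ht) (Eventually.of_forall fun r => h0 _)
        (Ioo_subset_Ioo_right (by norm_num)).eventuallyLE
    have h3 : ∫ r in Ioo (0 : ℝ) (1 / 2), m t * (1 / 2) ^ κ ≤
        ∫ r in Ioo (0 : ℝ) (1 / 2), m (t * (1 - r ^ 2)) := by
      refine setIntegral_mono_on (integrable_const _)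
        ((hint t ht).mono_set (Ioo_subset_Ioo_right (by norm_num))) measurableSet_Ioo ?_
      intro r h
      have h4 := mul_rpow_div_le_of_mul_deriv_le hd hu (half_pos ht) (half_le_self ht.le)
      rw [div_div_cancel_left' ht.ne', ← one_div] at h4
      exact h4.trans (hm (by nlinarith [h.1, h.2, mul_pos ht h.1]))
    rw [setIntegral_const] at h3
    simp only [Real.volume_real_Ioo, smul_eq_mul] at h3
    norm_num at h3
    have h5 := mul_le_mul_of_nonneg_left (h3.trans h2) (inv_pos.2 hκ0).le
    norm_num
    linarith
  · have h1 : t * ∫ r in Ioo (0 : ℝ) 1, deriv m (t * (1 - r ^ 2)) * (1 - r ^ 2) ≤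
        ∫ r in Ioo (0 : ℝ) 1, κ * m t := by
      rw [← integral_const_mul]
      refine setIntegral_mono_on (hi.const_mul _) (integrable_const _) measurableSet_Ioo ?_
      intro r h
      have h1 := hu _ (mul_pos ht (hr r h).1)
      have h2 : m (t * (1 - r ^ 2)) ≤ m t := hm (by nlinarith [(hr r h).2])
      have h3 := mul_le_mul_of_nonneg_left h2 hκ0.le
      linarith
    simpa using h1

/-- The layer-cake formula for `K_V`. -/
lemma KV_eq_integral_subMeas {V : ℝ → ℝ} (hc : Continuous V)
    (hz : ∀ s, s ≤ 0 → subMeas V s = 0) {t : ℝ} (ht : 0 < t) {a b : ℝ}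
    (hset : {x | V x ≤ t} = Icc a b) :
    KV V t = ∫ r in Ioo (0 : ℝ) 1, subMeas V (t * (1 - r ^ 2)) := by
  have h1 : KV V t = ∫ x, Real.sqrt (max (1 - V x / t) 0) := by
    rw [KV, ← integral_const_mul]
    congr 1
    ext x
    have : max (t - V x) 0 = t * max (1 - V x / t) 0 := by
      rw [mul_max_of_nonneg _ _ ht.le, mul_zero, mul_sub, mul_one, mul_div_cancel₀ _ ht.ne']
    rw [this, Real.sqrt_mul ht.le, ← mul_assoc, Real.sqrt_eq_rpow, ← Real.rpow_add ht]
    simp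
  have hint : Integrable (fun x => Real.sqrt (max (1 - V x / t) 0)) := by
    refine Continuous.integrable_of_hasCompactSupport (by fun_prop)
      (HasCompactSupport.intro (isCompact_Icc (a := a) (b := b)) fun x hx => ?_)
    rw [← hset, mem_ofPred_eq, not_le] at hx
    rw [max_eq_right, Real.sqrt_zero]
    rw [sub_nonpos, one_le_div ht]
    exact hx.le
  rw [h1, hint.integral_eq_integral_meas_le (Eventually.of_forall fun x => Real.sqrt_nonneg _)]
  have h2 : ∫ r in Ioi (0 : ℝ), volume.real {x | r ≤ Real.sqrt (max (1 - V x / t) 0)} =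
      ∫ r in Ioi (0 : ℝ), subMeas V (t * (1 - r ^ 2)) := by
    refine setIntegral_congr_fun measurableSet_Ioi fun r hr => ?_
    have hr : 0 < r := hr
    simp only [subMeas, Measure.real]
    congr 2
    ext x
    rw [mem_ofPred_eq, mem_ofPred_eq, Real.le_sqrt hr.le (le_max_right _ _), le_max_iff,
      or_iff_left (not_le.2 (pow_pos hr 2)), le_sub_comm, div_le_iff₀ ht, mul_comm]
  rw [h2]
  refine setIntegral_eq_of_subset_of_forall_sdiff_eq_zero measurableSet_Ioi
    (fun r hr => hr.1) fun r hr => hz _ ?_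
  have hr1 : 1 ≤ r := not_lt.1 fun h => hr.2 ⟨hr.1, h⟩
  nlinarith [mul_nonneg ht.le (by nlinarith : 0 ≤ r ^ 2 - 1)]

theorem KV_deriv_comparable (κ : ℝ) (hκ : 1 ≤ κ) :
    ∃ c C : ℝ, 0 < c ∧ 0 < C ∧
      ∀ V : ℝ → ℝ, P1 κ V → ∀ t : ℝ, 0 < t →
        DifferentiableAt ℝ (KV V) t ∧
        c * subMeas V t ≤ t * deriv (KV V) t ∧
        t * deriv (KV V) t ≤ C * subMeas V t := by
  refine ⟨κ⁻¹ * (1 / 2 * (1 / 2) ^ κ), κ, by positivity, by linarith, fun V hV t ht => ?_⟩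
  obtain ⟨hz, hm⟩ := hV.subMeas_spec hκ
  have hmono : Monotone (subMeas V) := by
    intro s s' h
    rcases le_or_gt s' 0 with h' | h'
    · rw [hz s (h.trans h'), hz s' h']
    · obtain ⟨a, b, hab⟩ := (hm s' h').1
      refine ENNReal.toReal_mono ?_ (measure_mono fun x hx => le_trans hx h)
      rw [hab]
      exact measure_Icc_lt_top.ne
  obtain ⟨d, hd, hlo, hhi⟩ := dilation_average_spec hκ hmono (fun s => ENNReal.toReal_nonneg)
    (fun s hs => (hm s hs).2.1) (fun s hs => (hm s hs).2.2.1) (fun s hs => (hm s hs).2.2.2) ht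
  have hD : HasDerivAt (KV V) d t := by
    refine hd.congr_of_eventuallyEq ((lt_mem_nhds ht).mono fun s hs => ?_)
    obtain ⟨a, b, hab⟩ := (hm s hs).1
    exact KV_eq_integral_subMeas hV.1 hz hs hab
  rw [hD.deriv]
  exact ⟨hD.differentiableAt, hlo, hhi⟩
end

section
/- Let V : ℝ → [0,∞) be continuous and differentiable on ℝ∖{0} with x·V'(x) ≥ 0 for all x ≠ 0. Let E ∈ ℝ and let ψ : ℝ → ℝ be a C² function satisfying −ψ'' + Vψ = Eψ on ℝ. Then for every x ∈ ℝ one has (E − V(x))·ψ(x)² + ψ'(x)² ≤ E·ψ(0)² + ψ'(0)². -/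
/-- Monotonicity bound: for a single-well-type potential (`x V'(x) ≥ 0`) and a
solution of `-ψ'' + V ψ = E ψ`, the quantity `(E - V) ψ² + (ψ')²` is maximized
at the origin. -/
theorem energy_max_at_origin (V : ℝ → ℝ) (hVc : Continuous V)
    (hV0 : ∀ x, 0 ≤ V x)
    (hVd : ∀ x : ℝ, x ≠ 0 → DifferentiableAt ℝ V x)
    (hVm : ∀ x : ℝ, x ≠ 0 → 0 ≤ x * deriv V x)
    (E : ℝ) (ψ : ℝ → ℝ) (hψ : ContDiff ℝ 2 ψ)
    (heq : ∀ x : ℝ, -deriv (deriv ψ) x + V x * ψ x = E * ψ x) :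
    ∀ x : ℝ, (E - V x) * ψ x ^ 2 + deriv ψ x ^ 2 ≤ E * ψ 0 ^ 2 + deriv ψ 0 ^ 2 := by
  have hd1 : Differentiable ℝ ψ := hψ.differentiable (by norm_num)
  have hd2 : Differentiable ℝ (deriv ψ) :=
    ((contDiff_succ_iff_deriv (n := 1)).1 (by simpa [one_add_one_eq_two] using hψ)).2.2.differentiable
      (by norm_num)
  set F : ℝ → ℝ := fun x => (E - V x) * ψ x ^ 2 + deriv ψ x ^ 2 with hF
  have hFc : Continuous F :=
    ((continuous_const.sub hVc).mul (hd1.continuous.pow 2)).add (hd2.continuous.pow 2)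
  have hFd : ∀ x : ℝ, x ≠ 0 → HasDerivAt F (-(deriv V x * ψ x ^ 2)) x := by
    intro x hx
    have h := (((hVd x hx).hasDerivAt.const_sub E).mul ((hd1 x).hasDerivAt.pow 2)).add
      ((hd2 x).hasDerivAt.pow 2)
    refine h.congr_deriv ?_
    have hode : deriv (deriv ψ) x = (V x - E) * ψ x := by linarith [heq x]
    simp only [hode, Pi.pow_apply]
    push_cast
    ring
  have hF0 : F 0 ≤ E * ψ 0 ^ 2 + deriv ψ 0 ^ 2 := by
    simp only [hF]
    nlinarith [mul_nonneg (hV0 0) (sq_nonneg (ψ 0))]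
  intro x
  refine le_trans (?_ : F x ≤ F 0) hF0
  rcases le_total 0 x with hx | hx
  · refine antitoneOn_of_deriv_nonpos (convex_Ici 0) hFc.continuousOn ?_ ?_
      Set.self_mem_Ici hx hx <;> rw [interior_Ici] <;> intro y (hy : 0 < y)
    · exact (hFd y hy.ne').differentiableAt.differentiableWithinAt
    · rw [(hFd y hy.ne').deriv]
      have hV_deriv := nonneg_of_mul_nonneg_right (hVm y hy.ne') hy
      exact neg_nonpos.2 (mul_nonneg hV_deriv (sq_nonneg _))
  · refine monotoneOn_of_deriv_nonneg (convex_Iic 0) hFc.continuousOn ?_ ?_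
      hx Set.self_mem_Iic hx <;> rw [interior_Iic] <;> intro y (hy : y < 0)
    · exact (hFd y hy.ne).differentiableAt.differentiableWithinAt
    · rw [(hFd y hy.ne).deriv]
      have hV_deriv : deriv V y ≤ 0 := by nlinarith [hVm y hy.ne]
      exact neg_nonneg.2 (mul_nonpos_of_nonpos_of_nonneg hV_deriv (sq_nonneg _))
end
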